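/- Let Z be an optimal and computable coding, let (X,T,μ) be an ergodic dynamical system with T-invariant probability measure μ, and let α = {A_1,…,A_m} be a finite measurable partition of X. Then for μ-almost every x ∈ X, K_Z(x,α) = h_μ(T,α); that is, limsup_{n→∞} |Z(φ_α(x)^n)|/n equals the entropy of T relative to the partition α. -/

import Mathlib

open Filter MeasureTheory
open scoped ENNReal

/-- The string of the first `n` symbols of an infinite sequence. -/
def pref {A : Type*} (ω : ℕ → A) (n : ℕ) : List A := (List.range n).map ω

/-- The finite set of `l`-blocks occurring in the string `s`. -/
def blocks {A : Type*} [DecidableEq A] (l : ℕ) (s : List A) : Finset (List A) :=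
  (Finset.range (s.length - l + 1)).image fun i => (s.drop i).take l

/-- Empirical frequency `P(s,w)`: number of occurrences of `w` as a block of consecutive
symbols of `s`, divided by `|s| - |w| + 1`. -/
noncomputable def empFreq {A : Type*} [DecidableEq A] (s : List A) (w : List A) : ℝ :=
  (((Finset.range (s.length - w.length + 1)).filter
      fun i => (s.drop i).take w.length = w).card : ℝ) / ((s.length - w.length + 1 : ℕ) : ℝ)

/-- The `l`-th empirical entropy `Ĥ_l(s) = -(1/l) Σ_w P(s,w) log₂ P(s,w)`
(words `w` with `P(s,w) = 0` contribute `0`, so it suffices to sum over occurring blocks). -/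
noncomputable def empEnt {A : Type*} [DecidableEq A] (l : ℕ) (s : List A) : ℝ :=
  -(1 / (l : ℝ)) * ∑ w ∈ blocks l s, empFreq s w * Real.logb 2 (empFreq s w)

/-- A coding `Z` is optimal if for every `k ≥ 1` there is `f_k = o(n)` with
`|Z(s)| ≤ |s|·Ĥ_k(s) + f_k(|s|)` for all strings `s` with `|s| ≥ k`. -/
def Optimal {A : Type*} [DecidableEq A] (Z : List A → List Bool) : Prop :=
  ∀ k : ℕ, 1 ≤ k → ∃ f : ℕ → ℝ,
    Filter.Tendsto (fun n : ℕ => f n / (n : ℝ)) Filter.atTop (nhds 0) ∧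
    ∀ s : List A, k ≤ s.length → ((Z s).length : ℝ) ≤ (s.length : ℝ) * empEnt k s + f s.length

/-- The sequence whose limit is the entropy `h_μ(T,α)` of `T` relative to the finite
measurable partition `α`. -/
noncomputable def relEntSeq {X : Type*} [MeasurableSpace X] (μ : Measure X)
    (T : X → X) {m : ℕ} (α : Fin m → Set X) (n : ℕ) : ℝ :=
  (1 / (n : ℝ)) * ∑ w : Fin n → Fin m,
    -((μ (⋂ i : Fin n, T^[(i : ℕ)] ⁻¹' α (w i))).toReal *
      Real.logb 2 ((μ (⋂ i : Fin n, T^[(i : ℕ)] ⁻¹' α (w i))).toReal))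

/-- The maximum of the first `n + 1` nonempty Birkhoff sums of `f`. -/
noncomputable def birkhoffMax {X : Type*} (T : X → X) (f : X → ℝ) : ℕ → X → ℝ
  | 0 => f
  | n + 1 => fun x => f x + max 0 (birkhoffMax T f n (T x))

lemma birkhoffMax_mono {X : Type*} (T : X → X) (f : X → ℝ) (x : X) :
    Monotone fun n => birkhoffMax T f n x := by
  refine monotone_nat_of_le_succ fun n => ?_
  induction n generalizing x with
  | zero => simp [birkhoffMax]
  | succ n ih =>
    simp only [birkhoffMax] at ih ⊢
    gcongr
    exact ih _

lemma birkhoffSum_le_birkhoffMax {X : Type*} (T : X → X) (f : X → ℝ) (n : ℕ) (x : X) :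
    birkhoffSum T f (n + 1) x ≤ birkhoffMax T f n x := by
  induction n generalizing x with
  | zero => simp [birkhoffMax, birkhoffSum_one]
  | succ n ih =>
    rw [birkhoffSum_succ']
    simp only [birkhoffMax]
    gcongr
    exact (ih _).trans (le_max_right _ _)

lemma measurable_birkhoffMax {X : Type*} [MeasurableSpace X] {T : X → X} (hT : Measurable T)
    {f : X → ℝ} (hf : Measurable f) (n : ℕ) : Measurable (birkhoffMax T f n) := by
  induction n with
  | zero => exact hf
  | succ n ih => exact hf.add (measurable_const.max (ih.comp hT))

lemma integrable_birkhoffMax {X : Type*} [MeasurableSpace X] {μ : Measure X} {T : X → X}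
    (hT : MeasurePreserving T μ μ) {f : X → ℝ} (hf : Integrable f μ) (n : ℕ) :
    Integrable (birkhoffMax T f n) μ := by
  induction n with
  | zero => exact hf
  | succ n ih =>
    exact hf.add ((integrable_zero _ _ _).sup (hT.integrable_comp_of_integrable ih))

lemma bddAbove_birkhoffMax_comp_iff {X : Type*} (T : X → X) (f : X → ℝ) (x : X) :
    BddAbove (Set.range fun n => birkhoffMax T f n (T x)) ↔
      BddAbove (Set.range fun n => birkhoffMax T f n x) := by
  constructor
  · rintro ⟨B, hB⟩
    refine ⟨f x + max 0 B, ?_⟩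
    rintro _ ⟨n, rfl⟩
    refine (birkhoffMax_mono T f x n.le_succ).trans ?_
    simp only [birkhoffMax]
    gcongr
    exact hB ⟨n, rfl⟩
  · rintro ⟨B, hB⟩
    refine ⟨B - f x, ?_⟩
    rintro _ ⟨n, rfl⟩
    have h : f x + max 0 (birkhoffMax T f n (T x)) ≤ B := hB ⟨n + 1, rfl⟩
    have := le_max_right 0 (birkhoffMax T f n (T x))
    simp only
    linarith

/-- If `f` has negative mean then its Birkhoff sums are almost surely bounded above. -/
lemma ae_bddAbove_birkhoffSum {X : Type*} [MeasurableSpace X] {μ : Measure X}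
    [IsProbabilityMeasure μ] {T : X → X} (hT : Ergodic T μ) {f : X → ℝ} (hfm : Measurable f)
    (hf : Integrable f μ) (hneg : ∫ x, f x ∂μ < 0) :
    ∀ᵐ x ∂μ, ∃ B, ∀ n, birkhoffSum T f (n + 1) x ≤ B := by
  have hmp := hT.toMeasurePreserving
  have hFm := measurable_birkhoffMax hmp.measurable hfm
  have hFi := integrable_birkhoffMax hmp hf
  have hA : MeasurableSet {x | BddAbove (Set.range fun n => birkhoffMax T f n x)} :=
    measurableSet_bddAbove_range hFm
  have hinv : T ⁻¹' {x | BddAbove (Set.range fun n => birkhoffMax T f n x)} =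
      {x | BddAbove (Set.range fun n => birkhoffMax T f n x)} :=
    Set.ext fun x => bddAbove_birkhoffMax_comp_iff T f x
  rcases hT.toPreErgodic.ae_mem_or_ae_notMem hA hinv with h | h
  · filter_upwards [h] with x ⟨B, hB⟩
    exact ⟨B, fun n => (birkhoffSum_le_birkhoffMax T f n x).trans (hB ⟨n, rfl⟩)⟩
  · exfalso
    have hFTi (n : ℕ) : Integrable (fun x => birkhoffMax T f n (T x)) μ :=
      hmp.integrable_comp_of_integrable (hFi n)
    have hnonneg (n : ℕ) :
        0 ≤ ∫ x, (birkhoffMax T f (n + 1) x - birkhoffMax T f n (T x)) ∂μ := by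
      have hcomp : ∫ x, birkhoffMax T f n (T x) ∂μ = ∫ x, birkhoffMax T f n x ∂μ := by
        have := integral_map (μ := μ) hmp.measurable.aemeasurable
          (f := birkhoffMax T f n) (hFm n).aestronglyMeasurable
        rw [← this, hmp.map_eq]
      rw [integral_sub (hFi _) (hFTi n), hcomp, sub_nonneg]
      exact integral_mono (hFi _) (hFi _) fun x => birkhoffMax_mono T f x n.le_succ
    have hlim : Tendsto
        (fun n : ℕ => ∫ x, (birkhoffMax T f (n + 1) x - birkhoffMax T f n (T x)) ∂μ)
        atTop (nhds (∫ x, f x ∂μ)) := by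
      refine tendsto_integral_of_dominated_convergence (fun x => |f x| + |f (T x)|)
        (fun n => ((hFi _).sub (hFTi n)).aestronglyMeasurable)
        (hf.abs.add (hmp.integrable_comp_of_integrable hf.abs)) (fun n => ?_) ?_
      · refine Eventually.of_forall fun x => ?_
        have h0 : f (T x) ≤ birkhoffMax T f n (T x) := birkhoffMax_mono T f (T x) n.zero_le
        simp only [birkhoffMax, Real.norm_eq_abs]
        rcases le_total 0 (birkhoffMax T f n (T x)) with hp | hp
        · rw [max_eq_right hp, add_sub_cancel_right]
          linarith [abs_nonneg (f (T x))]
        · rw [max_eq_left hp]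
          refine (abs_sub _ _).trans ?_
          have : |birkhoffMax T f n (T x)| ≤ |f (T x)| := abs_le_abs_of_nonpos hp h0
          simpa using this
      · filter_upwards [h] with x hx
        have hx' : ¬ BddAbove (Set.range fun n => birkhoffMax T f n (T x)) :=
          fun h' => hx ((bddAbove_birkhoffMax_comp_iff T f x).1 h')
        refine tendsto_const_nhds.congr' ?_
        have := tendsto_atTop_atTop_of_monotone' (birkhoffMax_mono T f (T x)) hx'
        filter_upwards [this.eventually_ge_atTop 0] with n hn
        simp only [birkhoffMax]
        rw [max_eq_right hn, add_sub_cancel_right]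
    exact absurd (ge_of_tendsto' hlim hnonneg) (not_le.2 hneg)

lemma ae_eventually_birkhoffSum_le {X : Type*} [MeasurableSpace X] {μ : Measure X}
    [IsProbabilityMeasure μ] {T : X → X} (hT : Ergodic T μ) {f : X → ℝ} (hfm : Measurable f)
    (hf : Integrable f μ) {ε : ℝ} (hε : 0 < ε) :
    ∀ᵐ x ∂μ, ∀ᶠ n : ℕ in atTop, birkhoffSum T f n x ≤ n * (∫ y, f y ∂μ + ε) := by
  have h := ae_bddAbove_birkhoffSum hT (f := fun x => f x - (∫ y, f y ∂μ + ε / 2))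
    (hfm.sub_const _) (hf.sub (integrable_const _)) (by
      rw [integral_sub hf (integrable_const _)]
      simp [hε])
  filter_upwards [h] with x ⟨B, hB⟩
  obtain ⟨N, hN⟩ := exists_nat_ge (B / (ε / 2))
  filter_upwards [eventually_ge_atTop (N + 1)] with n hn
  obtain ⟨k, rfl⟩ : ∃ k, n = k + 1 := ⟨n - 1, by omega⟩
  have hk := hB k
  have hNn : (N : ℝ) ≤ (k + 1 : ℕ) := by exact_mod_cast (by omega : N ≤ k + 1)
  have hsum : birkhoffSum T (fun x => f x - (∫ y, f y ∂μ + ε / 2)) (k + 1) x =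
      birkhoffSum T f (k + 1) x - (k + 1 : ℕ) * (∫ y, f y ∂μ + ε / 2) := by
    simp [birkhoffSum, Finset.sum_sub_distrib]
    ring
  rw [hsum] at hk
  have hB' : B ≤ (k + 1 : ℕ) * (ε / 2) := by
    rw [div_le_iff₀ (by positivity)] at hN
    exact hN.trans (by gcongr)
  linarith

/-- Birkhoff's pointwise ergodic theorem for an ergodic probability-preserving map. -/
lemma ae_tendsto_birkhoffAverage {X : Type*} [MeasurableSpace X] {μ : Measure X}
    [IsProbabilityMeasure μ] {T : X → X} (hT : Ergodic T μ) {f : X → ℝ} (hfm : Measurable f)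
    (hf : Integrable f μ) :
    ∀ᵐ x ∂μ, Tendsto (fun n : ℕ => birkhoffSum T f n x / n) atTop (nhds (∫ y, f y ∂μ)) := by
  have hup (j : ℕ) := ae_eventually_birkhoffSum_le hT hfm hf (Nat.one_div_pos_of_nat (n := j))
  have hlo (j : ℕ) := ae_eventually_birkhoffSum_le hT hfm.neg hf.neg
    (Nat.one_div_pos_of_nat (n := j))
  filter_upwards [ae_all_iff.2 hup, ae_all_iff.2 hlo] with x hux hlx
  rw [Metric.tendsto_atTop']
  intro ε hε
  obtain ⟨j, hj⟩ := exists_nat_one_div_lt hε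
  obtain ⟨N, hN⟩ := eventually_atTop.1 ((hux j).and (hlx j))
  refine ⟨N, fun n hn => ?_⟩
  obtain ⟨h1, h2⟩ := hN n hn.le
  have hn0 : (0 : ℝ) < n := by exact_mod_cast (by omega : 0 < n)
  have hneg : birkhoffSum T (-f) n x = -birkhoffSum T f n x := by
    simp [birkhoffSum]
  have hint : ∫ y, (-f) y ∂μ = -∫ y, f y ∂μ := integral_neg f
  rw [hneg, hint] at h2
  rw [Real.dist_eq]
  refine lt_of_le_of_lt ?_ hj
  rw [abs_le, le_sub_iff_add_le, sub_le_iff_le_add, le_div_iff₀ hn0, div_le_iff₀ hn0]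
  constructor <;> nlinarith

lemma pref_eq_ofFn {A : Type*} (ω : ℕ → A) (n : ℕ) :
    pref ω n = List.ofFn fun i : Fin n => ω i := by
  apply List.ext_getElem <;> simp [pref]

@[simp] lemma length_pref {A : Type*} (ω : ℕ → A) (n : ℕ) : (pref ω n).length = n := by
  simp [pref]

lemma take_drop_pref {A : Type*} (ω : ℕ → A) {n k i : ℕ} (h : i + k ≤ n) :
    ((pref ω n).drop i).take k = List.ofFn fun j : Fin k => ω (i + j) := by
  apply List.ext_getElem
  · simp; omega
  · simp [pref]

lemma empFreq_nonneg {A : Type*} [DecidableEq A] (s w : List A) : 0 ≤ empFreq s w := by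
  unfold empFreq; positivity

/-- The empirical entropy as a sum over all words of length `k`. -/
lemma empEnt_eq_sum {A : Type*} [DecidableEq A] [Fintype A] {k : ℕ} {s : List A}
    (h : k ≤ s.length) :
    empEnt k s = 1 / (k : ℝ) *
      ∑ w : Fin k → A, Real.negMulLog (empFreq s (List.ofFn w)) / Real.log 2 := by
  have himg : ∑ w ∈ blocks k s, empFreq s w * Real.logb 2 (empFreq s w) =
      ∑ w ∈ Finset.univ.image (fun w : Fin k → A => List.ofFn w),
        empFreq s w * Real.logb 2 (empFreq s w) := by
    refine Finset.sum_subset ?_ ?_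
    · intro w hw
      simp only [blocks, Finset.mem_image, Finset.mem_range] at hw
      obtain ⟨i, hi, rfl⟩ := hw
      have hlen : ((s.drop i).take k).length = k := by simp; omega
      simp only [Finset.mem_image, Finset.mem_univ, true_and]
      refine ⟨fun j => ((s.drop i).take k)[j]'(by omega), ?_⟩
      apply List.ext_getElem <;> simp [hlen]
    · intro w hw hw'
      simp only [Finset.mem_image, Finset.mem_univ, true_and] at hw
      obtain ⟨w, rfl⟩ := hw
      have : empFreq s (List.ofFn w) = 0 := by
        unfold empFreq
        rw [div_eq_zero_iff]
        left
        rw [Nat.cast_eq_zero, Finset.card_eq_zero, Finset.filter_eq_empty_iff]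
        intro i hi hiw
        apply hw'
        simp only [List.length_ofFn] at hi hiw
        exact Finset.mem_image.2 ⟨i, hi, hiw⟩
      rw [this, zero_mul]
  unfold empEnt
  rw [himg, Finset.sum_image fun a _ b _ hab => List.ofFn_injective hab, neg_mul,
    ← mul_neg, ← Finset.sum_neg_distrib]
  congr 1
  refine Finset.sum_congr rfl fun w _ => ?_
  rw [Real.negMulLog, Real.logb]
  ring

/-- The empirical entropies of order `k` are uniformly bounded. -/
lemma empEnt_le {A : Type*} [DecidableEq A] [Fintype A] {k : ℕ} {s : List A}
    (h : k ≤ s.length) :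
    empEnt k s ≤ 1 / (k : ℝ) * ∑ _w : Fin k → A, 1 / Real.log 2 := by
  rw [empEnt_eq_sum h]
  have hlog : 0 < Real.log 2 := Real.log_pos one_lt_two
  gcongr with w
  have h0 := empFreq_nonneg s (List.ofFn w)
  linarith [Real.negMulLog_le_one_sub_self h0]

lemma empFreq_pref {X A : Type*} [DecidableEq A] {T : X → X} {φ : X → ℕ → A}
    (hφ : ∀ x i j, φ (T^[i] x) j = φ x (i + j)) {n k : ℕ} (h : k ≤ n) (x : X) (w : Fin k → A) :
    empFreq (pref (φ x) n) (List.ofFn w) =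
      birkhoffSum T ({y | (fun j : Fin k => φ y j) = w}.indicator 1) (n - k + 1) x /
        ((n - k + 1 : ℕ) : ℝ) := by
  unfold empFreq birkhoffSum
  simp only [length_pref, List.length_ofFn]
  congr 1
  rw [Finset.card_filter, Nat.cast_sum]
  refine Finset.sum_congr rfl fun i hi => ?_
  rw [Finset.mem_range] at hi
  rw [take_drop_pref _ (by omega), Set.indicator_apply]
  simp only [Set.mem_ofPred_eq, hφ, List.ofFn_injective.eq_iff]
  split_ifs <;> simp

/-- The entropy, in bits, of the distribution of the first `n` symbols of the process `φ`. -/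
noncomputable def blockEntropy {X A : Type*} [MeasurableSpace X] [Fintype A] (μ : Measure X)
    (φ : X → ℕ → A) (n : ℕ) : ℝ :=
  ∑ w : Fin n → A, Real.negMulLog (μ.real {x | (fun j : Fin n => φ x j) = w}) / Real.log 2

lemma measurable_word {X A : Type*} [MeasurableSpace X] [MeasurableSpace A] {φ : X → ℕ → A}
    (hφ : ∀ i, Measurable fun x => φ x i) (n : ℕ) :
    Measurable fun x => fun j : Fin n => φ x j :=
  measurable_pi_lambda _ fun j => hφ j

lemma measurableSet_cylinder {X A : Type*} [MeasurableSpace X] [MeasurableSpace A] [Finite A]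
    [MeasurableSingletonClass A] {φ : X → ℕ → A} (hφ : ∀ i, Measurable fun x => φ x i) (n : ℕ)
    (w : Fin n → A) : MeasurableSet {x | (fun j : Fin n => φ x j) = w} :=
  measurable_word hφ n (measurableSet_singleton w)

/-- Almost surely, the empirical entropy of order `k` converges to the normalized block entropy. -/
lemma ae_tendsto_empEnt {X A : Type*} [MeasurableSpace X] [DecidableEq A] [Fintype A]
    [MeasurableSpace A] [MeasurableSingletonClass A] {μ : Measure X} [IsProbabilityMeasure μ]
    {T : X → X} (hT : Ergodic T μ) {φ : X → ℕ → A} (hφm : ∀ i, Measurable fun x => φ x i)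
    (hφ : ∀ x i j, φ (T^[i] x) j = φ x (i + j)) (k : ℕ) :
    ∀ᵐ x ∂μ, Tendsto (fun n => empEnt k (pref (φ x) n)) atTop
      (nhds (1 / (k : ℝ) * blockEntropy μ φ k)) := by
  have hcyl := measurableSet_cylinder hφm k
  have hb (w : Fin k → A) := ae_tendsto_birkhoffAverage hT
    (f := {y | (fun j : Fin k => φ y j) = w}.indicator 1)
    (measurable_one.indicator (hcyl w)) ((integrable_const (1 : ℝ)).indicator (hcyl w))
  filter_upwards [ae_all_iff.2 hb] with x hx
  have hshift : Tendsto (fun n : ℕ => n - k + 1) atTop atTop :=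
    tendsto_atTop_mono (fun n => by omega : ∀ n, n - k ≤ n - k + 1) (tendsto_sub_atTop_nat k)
  have hlim : Tendsto (fun n => 1 / (k : ℝ) *
      ∑ w : Fin k → A, Real.negMulLog (birkhoffSum T
        ({y | (fun j : Fin k => φ y j) = w}.indicator (1 : X → ℝ)) (n - k + 1) x /
        ((n - k + 1 : ℕ) : ℝ)) / Real.log 2)
      atTop (nhds (1 / (k : ℝ) * blockEntropy μ φ k)) := by
    refine Tendsto.const_mul _ (tendsto_finsetSum _ fun w _ => Tendsto.div_const ?_ _)
    refine (Real.continuous_negMulLog.tendsto _).comp ?_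
    have := (hx w).comp hshift
    rwa [integral_indicator_one (hcyl w)] at this
  refine hlim.congr' ?_
  filter_upwards [eventually_ge_atTop k] with n hn
  rw [empEnt_eq_sum (by simpa using hn)]
  simp_rw [empFreq_pref hφ hn]

lemma negMulLog_le_of_pos {p q : ℝ} (hp : 0 ≤ p) (hq : 0 < q) :
    Real.negMulLog p ≤ -(p * Real.log q) + (q - p) := by
  rcases hp.eq_or_lt with rfl | hp
  · simpa using hq.le
  · have h := Real.log_le_sub_one_of_pos (div_pos hq hp)
    rw [Real.log_div hq.ne' hp.ne'] at h
    have h' := mul_le_mul_of_nonneg_left h hp.le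
    have : p * (q / p - 1) = q - p := by field_simp
    rw [Real.negMulLog]
    linarith

/-- Gibbs' inequality for a subprobability with weights proportional to `2 ^ (-L w)`. -/
lemma sum_negMulLog_le {ι : Type*} [Fintype ι] {p : ι → ℝ} (hp : ∀ i, 0 ≤ p i)
    (hsum : ∑ i, p i = 1) (L : ι → ℕ) {K : ℝ} (hK : 0 < K)
    (hL : ∑ i, (2⁻¹ : ℝ) ^ L i ≤ K) :
    ∑ i, Real.negMulLog (p i) / Real.log 2 ≤ ∑ i, p i * L i + Real.logb 2 K := by
  have hlog : 0 < Real.log 2 := Real.log_pos one_lt_two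
  have hterm (i : ι) : Real.negMulLog (p i) ≤
      p i * L i * Real.log 2 + p i * Real.log K + ((2⁻¹ : ℝ) ^ L i / K - p i) := by
    refine (negMulLog_le_of_pos (hp i) (q := (2⁻¹ : ℝ) ^ L i / K) (by positivity)).trans ?_
    rw [Real.log_div (by positivity) hK.ne', Real.log_pow, Real.log_inv]
    apply le_of_eq
    ring
  rw [← Finset.sum_div, div_le_iff₀ hlog, add_mul, Real.logb, div_mul_cancel₀ _ hlog.ne']
  refine (Finset.sum_le_sum fun i _ => hterm i).trans ?_
  rw [Finset.sum_add_distrib, Finset.sum_add_distrib, Finset.sum_sub_distrib, ← Finset.sum_mul,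
    ← Finset.sum_mul, hsum, ← Finset.sum_div]
  have : (∑ i, (2⁻¹ : ℝ) ^ L i) / K ≤ 1 := (div_le_one hK).2 hL
  linarith

/-- A Kraft-type bound for an injective code with codewords of length at most `N`. -/
lemma sum_inv_two_pow_length_le {ι : Type*} [Fintype ι] {c : ι → List Bool}
    (hc : Function.Injective c) {N : ℕ} (hN : ∀ i, (c i).length ≤ N) :
    ∑ i, (2⁻¹ : ℝ) ^ (c i).length ≤ N + 1 := by
  classical
  rw [← Finset.sum_fiberwise_of_maps_to (s := Finset.univ) (t := Finset.range (N + 1))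
    (g := fun i => (c i).length) fun i _ => Finset.mem_range.2 (Nat.lt_succ_of_le (hN i))]
  calc _ ≤ ∑ _l ∈ Finset.range (N + 1), (1 : ℝ) := by
        refine Finset.sum_le_sum fun l _ => ?_
        rw [Finset.sum_congr rfl fun i hi => by rw [(Finset.mem_filter.1 hi).2]]
        rw [Finset.sum_const, nsmul_eq_mul, inv_pow, ← div_eq_mul_inv,
          div_le_one (by positivity)]
        have hcard : (Finset.univ.filter fun i => (c i).length = l).card ≤
            Fintype.card (List.Vector Bool l) := by
          refine (Finset.card_le_card_of_injOn c
            (t := Finset.univ.image (List.Vector.toList : List.Vector Bool l → List Bool))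
            (fun i hi => ?_) hc.injOn).trans Finset.card_image_le
          exact Finset.mem_coe.2 (Finset.mem_image.2
            ⟨⟨c i, (Finset.mem_filter.1 hi).2⟩, Finset.mem_univ _, rfl⟩)
        rw [card_vector, Fintype.card_bool] at hcard
        exact_mod_cast hcard
    _ = N + 1 := by simp

/-- The source coding inequality: the block entropy is at most the mean length of an
injective code, up to a logarithmic term. -/
lemma blockEntropy_le_integral {X A : Type*} [MeasurableSpace X] [Fintype A]
    [MeasurableSpace A] [MeasurableSingletonClass A] {μ : Measure X} [IsProbabilityMeasure μ]
    {φ : X → ℕ → A} (hφm : ∀ i, Measurable fun x => φ x i) {Z : List A → List Bool}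
    (hZ : Function.Injective Z) {n N : ℕ} (hN : ∀ s : List A, s.length = n → (Z s).length ≤ N) :
    blockEntropy μ φ n ≤
      ∫ x, ((Z (pref (φ x) n)).length : ℝ) ∂μ + Real.logb 2 (N + 1) := by
  have hm := measurable_word hφm n
  have hprob := Measure.isProbabilityMeasure_map (μ := μ) hm.aemeasurable
  have hreal (w : Fin n → A) : (μ.map fun x => fun j : Fin n => φ x j).real {w} =
      μ.real {x | (fun j : Fin n => φ x j) = w} :=
    map_measureReal_apply hm (measurableSet_singleton w)
  have hint : ∫ x, ((Z (pref (φ x) n)).length : ℝ) ∂μ =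
      ∑ w : Fin n → A, μ.real {x | (fun j : Fin n => φ x j) = w} *
        ((Z (List.ofFn w)).length : ℝ) := by
    have h := integral_map (μ := μ) hm.aemeasurable
      (f := fun w : Fin n → A => ((Z (List.ofFn w)).length : ℝ))
      (measurable_of_finite _).aestronglyMeasurable
    simp_rw [pref_eq_ofFn]
    rw [← h, integral_fintype .of_finite]
    simp_rw [hreal, smul_eq_mul]
  rw [hint]
  refine sum_negMulLog_le (fun _ => measureReal_nonneg) ?_ _ (by positivity)
    (sum_inv_two_pow_length_le (c := fun w : Fin n → A => Z (List.ofFn w))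
      (hZ.comp List.ofFn_injective) fun w => hN _ (by simp))
  simp_rw [← hreal, sum_measureReal_singleton]
  simp

lemma Optimal.exists_length_le {A : Type*} [DecidableEq A] [Fintype A] {Z : List A → List Bool}
    (hZ : Optimal Z) :
    ∃ C : ℕ, ∀ s : List A, 1 ≤ s.length → (Z s).length ≤ C * s.length := by
  obtain ⟨f, hf, hZf⟩ := hZ 1 le_rfl
  obtain ⟨B, hB⟩ := hf.bddAbove_range
  obtain ⟨C, hC⟩ := exists_nat_ge
    (1 / ((1 : ℕ) : ℝ) * ∑ _w : Fin 1 → A, 1 / Real.log 2 + B)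
  refine ⟨C, fun s hs => ?_⟩
  have hpos : (0 : ℝ) < s.length := by exact_mod_cast hs
  have hfB : f s.length ≤ B * s.length := (div_le_iff₀ hpos).1 (hB ⟨s.length, rfl⟩)
  have hE := mul_le_mul_of_nonneg_left (empEnt_le hs) hpos.le
  have hC' := mul_le_mul_of_nonneg_right hC hpos.le
  have := hZf s hs
  have hfin : ((Z s).length : ℝ) ≤ C * s.length := by linarith
  exact_mod_cast hfin

lemma tendsto_logb_mul_add_one_div (C : ℕ) :
    Tendsto (fun n : ℕ => Real.logb 2 ((C * n : ℕ) + 1) / n) atTop (nhds 0) := by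
  have h1 : Tendsto (fun x : ℝ => Real.log x / x) atTop (nhds 0) := by
    simpa using Real.isLittleO_log_id_atTop.tendsto_div_nhds_zero
  rcases C.eq_zero_or_pos with rfl | hC
  · simp
  have h2 : Tendsto (fun n : ℕ => ((C * n : ℕ) : ℝ) + 1) atTop atTop :=
    tendsto_atTop_add_const_right _ _ (tendsto_natCast_atTop_atTop.comp
      (tendsto_id.const_mul_atTop' hC))
  have h3 : Tendsto (fun n : ℕ => (C + 1 / (n : ℝ)) / Real.log 2) atTop
      (nhds ((C + 0) / Real.log 2)) :=
    (tendsto_const_nhds.add tendsto_one_div_atTop_nhds_zero_nat).div_const _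
  have h4 := (h1.comp h2).mul h3
  rw [zero_mul] at h4
  refine h4.congr' ?_
  filter_upwards [eventually_ge_atTop 1] with n hn
  have hn0 : (0 : ℝ) < n := by exact_mod_cast hn
  have hlog : 0 < Real.log 2 := Real.log_pos one_lt_two
  simp only [Function.comp_apply, Real.logb]
  push_cast
  have : (C : ℝ) * n + 1 ≠ 0 := by positivity
  field_simp

/-- A sequence of functions which is asymptotically at most `h` pointwise and whose means are
asymptotically at least `h` converges to `h` in mean. -/
lemma tendsto_integral_abs_sub {X : Type*} [MeasurableSpace X] {μ : Measure X}
    [IsProbabilityMeasure μ] {g : ℕ → X → ℝ} (hg : ∀ n, Measurable (g n)) {C h : ℝ}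
    (hC : ∀ n x, |g n x| ≤ C) (hup : ∀ᵐ x ∂μ, ∀ c > h, ∀ᶠ n in atTop, g n x ≤ c)
    {u : ℕ → ℝ} (hu : Tendsto u atTop (nhds h)) (hug : ∀ᶠ n in atTop, u n ≤ ∫ x, g n x ∂μ) :
    Tendsto (fun n => ∫ x, |g n x - h| ∂μ) atTop (nhds 0) := by
  have hint (n : ℕ) : Integrable (g n) μ :=
    Integrable.of_bound (hg n).aestronglyMeasurable C (Eventually.of_forall fun x => hC n x)
  have hsub (n : ℕ) : Integrable (fun x => g n x - h) μ := (hint n).sub (integrable_const _)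
  have hpos : Tendsto (fun n => ∫ x, max (g n x - h) 0 ∂μ) atTop (nhds (∫ _x, (0 : ℝ) ∂μ)) := by
    refine tendsto_integral_of_dominated_convergence (fun _ => C + |h|)
      (fun n => (((hg n).sub_const h).max measurable_const).aestronglyMeasurable)
      (integrable_const _) (fun n => Eventually.of_forall fun x => ?_) ?_
    · rw [Real.norm_eq_abs, abs_of_nonneg (le_max_right _ _)]
      have h1 := (abs_le.1 (hC n x)).2
      have h2 := neg_abs_le h
      have h3 := (abs_nonneg _).trans (hC n x)
      exact max_le (by linarith) (by positivity)
    · filter_upwards [hup] with x hx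
      rw [tendsto_order]
      refine ⟨fun a ha => Eventually.of_forall fun n => ha.trans_le (le_max_right _ _),
        fun a ha => ?_⟩
      filter_upwards [hx (h + a / 2) (by linarith)] with n hn
      exact max_lt (by linarith) ha
  rw [integral_zero] at hpos
  have hlim : Tendsto (fun n => 2 * ∫ x, max (g n x - h) 0 ∂μ - (u n - h)) atTop (nhds 0) := by
    simpa using (hpos.const_mul 2).sub (hu.sub_const h)
  refine tendsto_of_tendsto_of_tendsto_of_le_of_le' tendsto_const_nhds hlim
    (Eventually.of_forall fun n => integral_nonneg fun x => abs_nonneg _) ?_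
  filter_upwards [hug] with n hn
  have habs (x : X) : |g n x - h| = 2 * max (g n x - h) 0 - (g n x - h) := by
    rcases le_total (g n x - h) 0 with h0 | h0
    · rw [abs_of_nonpos h0, max_eq_right h0]; ring
    · rw [abs_of_nonneg h0, max_eq_left h0]; ring
  simp_rw [habs]
  have hmax : Integrable (fun x => max (g n x - h) 0) μ :=
    (hsub n).sup (integrable_zero _ _ _)
  rw [integral_sub (hmax.const_mul 2) (hsub n),
    integral_const_mul, integral_sub (hint n) (integrable_const _)]
  simp only [integral_const, probReal_univ, one_smul]
  linarith

lemma ae_limsup_eq {X : Type*} [MeasurableSpace X] {μ : Measure X}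
    [IsProbabilityMeasure μ] {g : ℕ → X → ℝ} (hg : ∀ n, Measurable (g n)) {C h : ℝ}
    (hC : ∀ n x, |g n x| ≤ C) (hup : ∀ᵐ x ∂μ, ∀ c > h, ∀ᶠ n in atTop, g n x ≤ c)
    {u : ℕ → ℝ} (hu : Tendsto u atTop (nhds h)) (hug : ∀ᶠ n in atTop, u n ≤ ∫ x, g n x ∂μ) :
    ∀ᵐ x ∂μ, atTop.limsup (fun n => g n x) = h := by
  have hL1 := tendsto_integral_abs_sub hg hC hup hu hug
  have hmeas : TendstoInMeasure μ g atTop fun _ => h := by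
    refine tendstoInMeasure_of_tendsto_eLpNorm one_ne_zero
      (fun n => (hg n).aestronglyMeasurable) aestronglyMeasurable_const ?_
    have hint (n : ℕ) : Integrable (g n - fun _ => h) μ :=
      (Integrable.of_bound (hg n).aestronglyMeasurable C
        (Eventually.of_forall fun x => hC n x)).sub (integrable_const _)
    simp_rw [eLpNorm_one_eq_lintegral_enorm, ← ofReal_integral_norm_eq_lintegral_enorm (hint _)]
    simpa using ENNReal.tendsto_ofReal hL1
  obtain ⟨ns, hns, hlim⟩ := hmeas.exists_seq_tendsto_ae
  filter_upwards [hlim, hup] with x hx hxup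
  have hbdd : IsBoundedUnder (· ≤ ·) atTop fun n => g n x :=
    isBoundedUnder_of ⟨C, fun n => (abs_le.1 (hC n x)).2⟩
  have hcobdd : IsCoboundedUnder (· ≤ ·) atTop fun n => g n x :=
    (isBoundedUnder_of ⟨-C, fun n => (abs_le.1 (hC n x)).1⟩ :
      IsBoundedUnder (· ≥ ·) atTop fun n => g n x).isCoboundedUnder_le
  refine le_antisymm (le_of_forall_gt_imp_ge_of_dense fun c hc =>
    limsup_le_of_le hcobdd (hxup c hc)) (le_of_forall_lt_imp_le_of_dense fun c hc => ?_)
  refine le_limsup_of_frequently_le (hns.tendsto_atTop.frequently ?_) hbdd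
  exact ((hx.eventually (lt_mem_nhds hc)).mono fun _ => le_of_lt).frequently

/-- An optimal injective code compresses almost every orbit of a finite-valued ergodic process
to its entropy rate. -/
lemma ae_limsup_length_code_eq {X A : Type*} [MeasurableSpace X] [DecidableEq A] [Fintype A]
    [MeasurableSpace A] [MeasurableSingletonClass A] {μ : Measure X} [IsProbabilityMeasure μ]
    {T : X → X} (hT : Ergodic T μ) {φ : X → ℕ → A} (hφm : ∀ i, Measurable fun x => φ x i)
    (hφ : ∀ x i j, φ (T^[i] x) j = φ x (i + j)) {Z : List A → List Bool}
    (hZ : Function.Injective Z) (hopt : Optimal Z) {h : ℝ}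
    (hent : Tendsto (fun n : ℕ => 1 / (n : ℝ) * blockEntropy μ φ n) atTop (nhds h)) :
    ∀ᵐ x ∂μ, atTop.limsup (fun n : ℕ => ((Z (pref (φ x) n)).length : ℝ) / (n : ℝ)) = h := by
  obtain ⟨C, hC⟩ := hopt.exists_length_le
  have hlen {n : ℕ} (hn : 1 ≤ n) (s : List A) (hs : s.length = n) : (Z s).length ≤ C * n := by
    subst hs
    exact hC s hn
  refine ae_limsup_eq (C := C)
    (u := fun n : ℕ => 1 / (n : ℝ) * blockEntropy μ φ n - Real.logb 2 ((C * n : ℕ) + 1) / n)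
    (fun n => ?_) (fun n x => ?_) ?_ ?_ ?_
  · simp_rw [pref_eq_ofFn]
    exact (measurable_of_finite fun w : Fin n → A =>
      ((Z (List.ofFn w)).length : ℝ) / (n : ℝ)).comp (measurable_word hφm n)
  · rw [abs_of_nonneg (by positivity)]
    rcases n.eq_zero_or_pos with rfl | hn
    · simp
    · rw [div_le_iff₀ (by exact_mod_cast hn)]
      exact_mod_cast hlen hn _ (length_pref _ _)
  · filter_upwards [ae_all_iff.2 (ae_tendsto_empEnt hT hφm hφ)] with x hx c hc
    obtain ⟨k, hk, hk1⟩ :=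
      ((hent.eventually (gt_mem_nhds hc)).and (eventually_ge_atTop 1)).exists
    obtain ⟨f, hf, hZf⟩ := hopt k hk1
    have hlim := (hx k).add hf
    rw [add_zero] at hlim
    filter_upwards [hlim.eventually (gt_mem_nhds hk), eventually_ge_atTop k] with n hn hkn
    have hn0 : (0 : ℝ) < n := by exact_mod_cast hk1.trans hkn
    have hs := hZf (pref (φ x) n) (by simpa using hkn)
    rw [length_pref] at hs
    refine le_trans ?_ hn.le
    rw [div_le_iff₀ hn0, add_mul, div_mul_cancel₀ _ hn0.ne']
    linarith
  · simpa using hent.sub (tendsto_logb_mul_add_one_div C)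
  · filter_upwards [eventually_ge_atTop 1] with n hn
    have hn0 : (0 : ℝ) < n := by exact_mod_cast hn
    have hle := blockEntropy_le_integral (μ := μ) hφm hZ (hlen hn)
    rw [integral_div, sub_le_iff_le_add, ← add_div, one_div_mul_eq_div]
    gcongr

/-- If `Z` is an optimal computable coding, `(X,T,μ)` is ergodic and `α` is a finite
measurable partition of `X`, then for `μ`-almost every `x`,
`K_Z(x,α) = limsup_n |Z(φ_α(x)ⁿ)|/n` equals `h_μ(T,α)` (given as the limit `hα` of the
relative entropy sequence). -/
theorem stmt_12 {X : Type*} [MeasurableSpace X]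
    (μ : Measure X) [IsProbabilityMeasure μ]
    (T : X → X) (herg : Ergodic T μ)
    (m : ℕ) (hm : 0 < m) (α : Fin m → Set X)
    (hαmeas : ∀ j, MeasurableSet (α j))
    (hαdisj : ∀ i j, i ≠ j → Disjoint (α i) (α j))
    (hαcover : (⋃ j, α j) = Set.univ)
    (φ : X → ℕ → Fin m)
    (hφ : ∀ x (i : ℕ) (j : Fin m), T^[i] x ∈ α j ↔ φ x i = j)
    (e : List (Fin m) ≃ ℕ) (he : Computable fun s : List (Fin m) => e s)
    (he' : Computable fun n : ℕ => e.symm n)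
    (b : List Bool ≃ ℕ) (hb : Computable fun s : List Bool => b s)
    (hb' : Computable fun n : ℕ => b.symm n)
    (Z : List (Fin m) → List Bool) (hZinj : Function.Injective Z) (hZopt : Optimal Z)
    (hZcomp : Computable fun n : ℕ => b (Z (e.symm n)))
    (hα : ℝ) (hent : Filter.Tendsto (relEntSeq μ T α) Filter.atTop (nhds hα)) :
    ∀ᵐ x ∂μ,
      Filter.atTop.limsup (fun n : ℕ => ((Z (pref (φ x) n)).length : ℝ) / (n : ℝ)) = hα := by
  have hshift (x : X) (i j : ℕ) : φ (T^[i] x) j = φ x (i + j) := by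
    rw [← hφ, ← Function.iterate_add_apply, add_comm j i, hφ]
  have hmeas (i : ℕ) : Measurable fun x => φ x i := by
    refine measurable_to_countable' fun j => ?_
    have : (fun x => φ x i) ⁻¹' {j} = T^[i] ⁻¹' α j := Set.ext fun x => (hφ x i j).symm
    rw [this]
    exact herg.measurable.iterate i (hαmeas j)
  refine ae_limsup_length_code_eq herg hmeas hshift hZinj hZopt (hent.congr fun n => ?_)
  unfold relEntSeq blockEntropy
  congr 1
  refine Finset.sum_congr rfl fun w _ => ?_
  have : (⋂ i : Fin n, T^[(i : ℕ)] ⁻¹' α (w i)) = {x | (fun j : Fin n => φ x j) = w} := by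
    ext x
    simp only [Set.mem_iInter, Set.mem_preimage, hφ, Set.mem_ofPred_eq, funext_iff]
  rw [this, Real.negMulLog, Real.logb, measureReal_def]
  ring
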